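/- arXiv:1311.5168 — 3 statements merged into one kernel-verified Lean document; each statement's English description precedes it below -/
import Mathlib

section
/- Let e : [0,∞) → [0,1] be measurable, and let g, h : ℝ³ → ℝ be measurable functions such that ∫∫ |g(v_*)| |h(v)| |v − v_*|³ dv_* dv < ∞. For v ≠ v_*, u := v − v_*, û := u/|u|, a unit vector σ, set ε := e(|u| √((1 − û·σ)/2)) and define v', v'_* by v' = v − ((1+ε)/2)·(u − |u|σ)/2 and v'_* = v_* + ((1+ε)/2)·(u − |u|σ)/2. Then ∫_{ℝ³} ∫_{ℝ³} ∫_{S²} g(v_*) h(v) |v − v_*| (|v'|² + |v'_*|² − |v|² − |v_*|²) dσ dv_* dv = − ∫_{ℝ³} ∫_{ℝ³} g(v_*) h(v) ψ_e(|v − v_*|²) dv_* dv, where ψ_e(r) := 4π r^{3/2} ∫₀¹ (1 − e(√r z)²) z³ dz. -/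
open MeasureTheory
open scoped RealInnerProductSpace

/-- `ψ_e(r) = 4π r^{3/2} ∫₀¹ (1 - e(√r z)²) z³ dz`. -/
noncomputable def psiE (e : ℝ → ℝ) (r : ℝ) : ℝ :=
  4 * Real.pi * r ^ ((3:ℝ)/2) * ∫ z in (0:ℝ)..1, (1 - (e (Real.sqrt r * z)) ^ 2) * z ^ 3

/-- The post-collisional velocity `v' = v - ((1+ε)/2)·(u - |u|σ)/2` with
`u = v - v_*`, `û = u/|u|` and `ε = e(|u|√((1 - û·σ)/2))`. -/
noncomputable def postV (e : ℝ → ℝ) (v vs : EuclideanSpace ℝ (Fin 3))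
    (σ : Metric.sphere (0 : EuclideanSpace ℝ (Fin 3)) 1) : EuclideanSpace ℝ (Fin 3) :=
  let u := v - vs
  let ε := e (‖u‖ * Real.sqrt ((1 - ⟪‖u‖⁻¹ • u, (σ : EuclideanSpace ℝ (Fin 3))⟫) / 2))
  v - ((1 + ε) / 2) • ((2:ℝ)⁻¹ • (u - ‖u‖ • (σ : EuclideanSpace ℝ (Fin 3))))

/-- The post-collisional velocity `v'_* = v_* + ((1+ε)/2)·(u - |u|σ)/2` with
`u = v - v_*`, `û = u/|u|` and `ε = e(|u|√((1 - û·σ)/2))`. -/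
noncomputable def postVs (e : ℝ → ℝ) (v vs : EuclideanSpace ℝ (Fin 3))
    (σ : Metric.sphere (0 : EuclideanSpace ℝ (Fin 3)) 1) : EuclideanSpace ℝ (Fin 3) :=
  let u := v - vs
  let ε := e (‖u‖ * Real.sqrt ((1 - ⟪‖u‖⁻¹ • u, (σ : EuclideanSpace ℝ (Fin 3))⟫) / 2))
  vs + ((1 + ε) / 2) • ((2:ℝ)⁻¹ • (u - ‖u‖ • (σ : EuclideanSpace ℝ (Fin 3))))

open scoped ENNReal

/-- Integration in polar coordinates of a product of a radial and an angular function. -/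
lemma lintegral_radial_mul_angular {E : Type*} [NormedAddCommGroup E] [NormedSpace ℝ E]
    [FiniteDimensional ℝ E] [Nontrivial E] [MeasurableSpace E] [BorelSpace E]
    (μ : Measure E) [μ.IsAddHaarMeasure]
    {f : ℝ → ℝ≥0∞} (hf : Measurable f) {G : E → ℝ≥0∞} (hG : Measurable G) :
    ∫⁻ x, f ‖x‖ * G (‖x‖⁻¹ • x) ∂μ =
      (∫⁻ σ : Metric.sphere (0 : E) 1, G σ ∂μ.toSphere) *
        ∫⁻ r in Set.Ioi (0 : ℝ), ENNReal.ofReal (r ^ (Module.finrank ℝ E - 1)) * f r := by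
  calc
    _ = ∫⁻ x : ({(0 : E)}ᶜ : Set E), f ‖x.1‖ * G (‖x.1‖⁻¹ • x.1) ∂(μ.comap (↑)) := by
      rw [lintegral_subtype_comap (measurableSet_singleton _).compl
        (fun x => f ‖x‖ * G (‖x‖⁻¹ • x)), restrict_compl_singleton]
    _ = ∫⁻ p : Metric.sphere (0 : E) 1 × Set.Ioi (0 : ℝ), G p.1 * f p.2
          ∂(μ.toSphere.prod (.volumeIoiPow (Module.finrank ℝ E - 1))) := by
      rw [← (μ.measurePreserving_homeomorphUnitSphereProd).lintegral_comp_emb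
        (Homeomorph.measurableEmbedding _)]
      refine lintegral_congr fun x => ?_
      simp [mul_comm]
    _ = _ := by
      rw [lintegral_prod_mul (f := fun σ : Metric.sphere (0 : E) 1 => G σ)
        (g := fun r : Set.Ioi (0 : ℝ) => f r)
        (hG.comp measurable_subtype_coe).aemeasurable
        (hf.comp measurable_subtype_coe).aemeasurable, Measure.volumeIoiPow,
        lintegral_withDensity_eq_lintegral_mul _ (by fun_prop) (by fun_prop)]
      congr 1
      exact lintegral_subtype_comap measurableSet_Ioi
        (fun r => ENNReal.ofReal (r ^ (Module.finrank ℝ E - 1)) * f r)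

/-- Integration in planar polar coordinates of a radial function. -/
lemma lintegral_sqrt_add_sq {f : ℝ → ℝ≥0∞} (hf : Measurable f) :
    ∫⁻ p : ℝ × ℝ, f (√(p.1 ^ 2 + p.2 ^ 2)) =
      ENNReal.ofReal (2 * Real.pi) * ∫⁻ r in Set.Ioi (0 : ℝ), ENNReal.ofReal r * f r := by
  rw [← lintegral_comp_polarCoord_symm]
  have h : ∀ p ∈ polarCoord.target, ENNReal.ofReal p.1 •
      f (√((polarCoord.symm p).1 ^ 2 + (polarCoord.symm p).2 ^ 2)) =
      ENNReal.ofReal p.1 * f p.1 * 1 := by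
    rintro ⟨r, θ⟩ ⟨hr, -⟩
    have : (r * Real.cos θ) ^ 2 + (r * Real.sin θ) ^ 2 = r ^ 2 := by
      linear_combination r ^ 2 * Real.sin_sq_add_cos_sq θ
    simp only [polarCoord_symm_apply, this, Real.sqrt_sq (le_of_lt hr), smul_eq_mul, mul_one]
  rw [setLIntegral_congr_fun polarCoord.open_target.measurableSet h, polarCoord_target,
    Measure.volume_eq_prod, ← Measure.prod_restrict,
    lintegral_prod_mul (f := fun r => ENNReal.ofReal r * f r) (g := fun _ => 1)
      (by fun_prop) (by fun_prop), mul_comm]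
  simp [two_mul]

/-- Integration in cylindrical coordinates of an axially symmetric function. -/
lemma lintegral_cylindrical {Φ : ℝ → ℝ → ℝ≥0∞} (hΦ : Measurable (Function.uncurry Φ)) :
    ∫⁻ x : EuclideanSpace ℝ (Fin 3), Φ (x 0) (√(x 1 ^ 2 + x 2 ^ 2)) =
      ENNReal.ofReal (2 * Real.pi) *
        ∫⁻ s, ∫⁻ r in Set.Ioi (0 : ℝ), ENNReal.ofReal r * Φ s r := by
  have hm : Measurable fun p : ℝ × ℝ × ℝ => Φ p.1 (√(p.2.1 ^ 2 + p.2.2 ^ 2)) :=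
    hΦ.comp (f := fun p : ℝ × ℝ × ℝ => (p.1, √(p.2.1 ^ 2 + p.2.2 ^ 2))) (by fun_prop)
  have hmp := ((MeasurePreserving.id volume).prod (volume_preserving_finTwoArrow ℝ)).comp
    ((volume_preserving_piFinSuccAbove (fun _ : Fin 3 => ℝ) 0).comp
      (PiLp.volume_preserving_ofLp (Fin 3)))
  calc
    _ = ∫⁻ p : ℝ × ℝ × ℝ, Φ p.1 (√(p.2.1 ^ 2 + p.2.2 ^ 2)) :=
      hmp.lintegral_comp hm
    _ = ∫⁻ s, ∫⁻ q : ℝ × ℝ, Φ s (√(q.1 ^ 2 + q.2 ^ 2)) := by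
      rw [Measure.volume_eq_prod, lintegral_prod _ hm.aemeasurable]
    _ = _ := by
      rw [← lintegral_const_mul' _ _ ENNReal.ofReal_ne_top]
      exact lintegral_congr fun s => lintegral_sqrt_add_sq (hΦ.comp measurable_prodMk_left)

/-- Integration over the half-plane in polar coordinates, with the weight given by the distance
to the axis. -/
lemma lintegral_halfPlane_polar {f F : ℝ → ℝ≥0∞} (hf : Measurable f) (hF : Measurable F) :
    ∫⁻ s, ∫⁻ r in Set.Ioi (0 : ℝ),
        ENNReal.ofReal r * (f (√(s ^ 2 + r ^ 2)) * F ((√(s ^ 2 + r ^ 2))⁻¹ * s)) =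
      (∫⁻ r in Set.Ioi (0 : ℝ), ENNReal.ofReal (r ^ 2) * f r) *
        ∫⁻ θ in Set.Ioo 0 Real.pi, ENNReal.ofReal (Real.sin θ) * F (Real.cos θ) := by
  have hind : ∀ s, ∫⁻ r in Set.Ioi (0 : ℝ),
      ENNReal.ofReal r * (f (√(s ^ 2 + r ^ 2)) * F ((√(s ^ 2 + r ^ 2))⁻¹ * s)) =
      ∫⁻ r, ENNReal.ofReal r * (f (√(s ^ 2 + r ^ 2)) * F ((√(s ^ 2 + r ^ 2))⁻¹ * s)) := by
    intro s
    refine setLIntegral_eq_of_support_subset fun r hr => ?_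
    by_contra h
    exact hr (by simp [ENNReal.ofReal_of_nonpos (not_lt.1 h)])
  have hm : Measurable fun p : ℝ × ℝ => ENNReal.ofReal p.2 *
      (f (√(p.1 ^ 2 + p.2 ^ 2)) * F ((√(p.1 ^ 2 + p.2 ^ 2))⁻¹ * p.1)) := by fun_prop
  simp_rw [hind]
  rw [← lintegral_prod _ hm.aemeasurable, ← Measure.volume_eq_prod,
    ← lintegral_comp_polarCoord_symm]
  have h : ∀ p ∈ polarCoord.target, ENNReal.ofReal p.1 •
      (ENNReal.ofReal (polarCoord.symm p).2 *
      (f (√((polarCoord.symm p).1 ^ 2 + (polarCoord.symm p).2 ^ 2)) *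
        F ((√((polarCoord.symm p).1 ^ 2 + (polarCoord.symm p).2 ^ 2))⁻¹ *
          (polarCoord.symm p).1))) =
      ENNReal.ofReal (p.1 ^ 2) * f p.1 *
        (ENNReal.ofReal (Real.sin p.2) * F (Real.cos p.2)) := by
    rintro ⟨r, θ⟩ ⟨hr, -⟩
    have hr : 0 < r := hr
    have : (r * Real.cos θ) ^ 2 + (r * Real.sin θ) ^ 2 = r ^ 2 := by
      linear_combination r ^ 2 * Real.sin_sq_add_cos_sq θ
    simp only [polarCoord_symm_apply, this, Real.sqrt_sq hr.le, smul_eq_mul,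
      inv_mul_cancel_left₀ hr.ne', ENNReal.ofReal_mul hr.le, ENNReal.ofReal_pow hr.le]
    ring
  rw [setLIntegral_congr_fun polarCoord.open_target.measurableSet h, polarCoord_target,
    Measure.volume_eq_prod, ← Measure.prod_restrict,
    lintegral_prod_mul (f := fun r => ENNReal.ofReal (r ^ 2) * f r)
      (g := fun θ => ENNReal.ofReal (Real.sin θ) * F (Real.cos θ))
      (by fun_prop) (by fun_prop)]
  congr 1
  rw [← lintegral_indicator measurableSet_Ioo, ← lintegral_indicator measurableSet_Ioo]
  refine lintegral_congr fun θ => ?_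
  by_cases h0 : 0 < θ
  · simp [Set.indicator, h0, show -Real.pi < θ by linarith [Real.pi_pos]]
  · by_cases hπ : -Real.pi < θ
    · simp [Set.indicator, h0,
        ENNReal.ofReal_of_nonpos (Real.sin_nonpos_of_nonpos_of_neg_pi_le (not_lt.1 h0) hπ.le)]
    · simp [Set.indicator, h0, hπ]

/-- Integration over the unit sphere of a function of the component along a unit vector. -/
lemma lintegral_sphere_inner {n : EuclideanSpace ℝ (Fin 3)} (hn : ‖n‖ = 1)
    {F : ℝ → ℝ≥0∞} (hF : Measurable F) :
    ∫⁻ σ : Metric.sphere (0 : EuclideanSpace ℝ (Fin 3)) 1,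
        F ⟪n, (σ : EuclideanSpace ℝ (Fin 3))⟫
        ∂(volume : Measure (EuclideanSpace ℝ (Fin 3))).toSphere =
      ENNReal.ofReal (2 * Real.pi) *
        ∫⁻ θ in Set.Ioo 0 Real.pi, ENNReal.ofReal (Real.sin θ) * F (Real.cos θ) := by
  obtain ⟨b, hb⟩ := Orthonormal.exists_orthonormalBasis_extension_of_card_eq (𝕜 := ℝ)
    (E := EuclideanSpace ℝ (Fin 3)) (ι := Fin 3) (by simp) (v := fun _ => n) (s := {0})
    ⟨fun _ => hn, fun i j hij => (hij (Subsingleton.elim i j)).elim⟩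
  have hb : b 0 = n := hb 0 rfl
  set f : ℝ → ℝ≥0∞ := (Set.Iio 1).indicator 1
  have hf : Measurable f := measurable_one.indicator measurableSet_Iio
  have hC : ∫⁻ r in Set.Ioi (0 : ℝ), ENNReal.ofReal (r ^ 2) * f r = ENNReal.ofReal (1 / 3) := by
    have h (r : ℝ) : ENNReal.ofReal (r ^ 2) * f r =
        (Set.Iio (1 : ℝ)).indicator (fun r => ENNReal.ofReal (r ^ 2)) r := by
      by_cases hr : r < 1 <;> simp [f, hr]
    simp_rw [h]
    rw [setLIntegral_indicator measurableSet_Iio, Set.Iio_inter_Ioi, restrict_Ioo_eq_restrict_Ioc,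
      ← ofReal_integral_eq_lintegral_ofReal
        (intervalIntegral.intervalIntegrable_pow (μ := volume) (a := 0) (b := 1) 2).1
        (.of_forall fun r => sq_nonneg r), ← intervalIntegral.integral_of_le zero_le_one]
    norm_num
  have hpolar := lintegral_radial_mul_angular (volume : Measure (EuclideanSpace ℝ (Fin 3))) hf
    (G := fun x => F ⟪n, x⟫) (by fun_prop)
  have hcyl : ∫⁻ x : EuclideanSpace ℝ (Fin 3), f ‖x‖ * F ⟪n, ‖x‖⁻¹ • x⟫ =
      ∫⁻ x : EuclideanSpace ℝ (Fin 3),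
        f (√(x 0 ^ 2 + √(x 1 ^ 2 + x 2 ^ 2) ^ 2)) *
        F ((√(x 0 ^ 2 + √(x 1 ^ 2 + x 2 ^ 2) ^ 2))⁻¹ * x 0) := by
    refine Eq.trans (lintegral_congr fun x => ?_) (b.measurePreserving_repr.lintegral_comp
      (f := fun x => f (√(x 0 ^ 2 + √(x 1 ^ 2 + x 2 ^ 2) ^ 2)) *
        F ((√(x 0 ^ 2 + √(x 1 ^ 2 + x 2 ^ 2) ^ 2))⁻¹ * x 0)) (by fun_prop))
    have h1 : ‖x‖ = √(b.repr x 0 ^ 2 + √(b.repr x 1 ^ 2 + b.repr x 2 ^ 2) ^ 2) := by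
      rw [← b.repr.norm_map x, EuclideanSpace.norm_eq, Fin.sum_univ_three,
        Real.sq_sqrt (by positivity)]
      simp [add_assoc]
    rw [← h1, b.repr_apply_apply x 0, hb, real_inner_smul_right]
  rw [hcyl, lintegral_cylindrical (Φ := fun s r => f (√(s ^ 2 + r ^ 2)) *
    F ((√(s ^ 2 + r ^ 2))⁻¹ * s)) (by unfold Function.uncurry; fun_prop),
    lintegral_halfPlane_polar hf hF] at hpolar
  simp only [finrank_euclideanSpace, Fintype.card_fin, Nat.add_one_sub_one, hC] at hpolar
  rw [mul_left_comm, mul_comm] at hpolar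
  exact ((ENNReal.mul_left_inj (by simp) ENNReal.ofReal_ne_top).1 hpolar).symm

/-- The substitution `z = sin (θ / 2)`. -/
lemma lintegral_sin_half (Φ : ℝ → ℝ≥0∞) :
    ∫⁻ θ in Set.Ioo 0 Real.pi, ENNReal.ofReal (Real.sin θ) * Φ (√((1 - Real.cos θ) / 2)) =
      ∫⁻ z in Set.Ioo (0 : ℝ) 1, ENNReal.ofReal (4 * z) * Φ z := by
  have himg : (fun θ : ℝ => Real.sin (θ / 2)) '' Set.Ioo 0 Real.pi = Set.Ioo 0 1 := by
    ext z
    constructor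
    · rintro ⟨θ, ⟨h0, h1⟩, rfl⟩
      refine ⟨Real.sin_pos_of_pos_of_lt_pi (by linarith) (by linarith), ?_⟩
      rw [← Real.sin_pi_div_two]
      exact Real.sin_lt_sin_of_lt_of_le_pi_div_two (by linarith) le_rfl (by linarith)
    · rintro ⟨h0, h1⟩
      refine ⟨2 * Real.arcsin z, ⟨?_, ?_⟩, ?_⟩
      · linarith [Real.arcsin_pos.2 h0]
      · linarith [Real.arcsin_lt_pi_div_two.2 h1]
      · simp [Real.sin_arcsin (by linarith) h1.le]
  have hinj : Set.InjOn (fun θ : ℝ => Real.sin (θ / 2)) (Set.Ioo 0 Real.pi) := by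
    rintro x ⟨hx0, hx1⟩ y ⟨hy0, hy1⟩ hxy
    have := Real.injOn_sin ⟨by linarith, by linarith⟩ ⟨by linarith, by linarith⟩ hxy
    linarith
  rw [← himg, lintegral_image_eq_lintegral_abs_deriv_mul measurableSet_Ioo
    (f := fun θ : ℝ => Real.sin (θ / 2)) (f' := fun θ => Real.cos (θ / 2) * (1 / 2))
    (fun θ _ => ((hasDerivAt_id θ).div_const 2).sin.hasDerivWithinAt) hinj]
  refine setLIntegral_congr_fun measurableSet_Ioo fun θ hθ => ?_
  have hs : 0 < Real.sin (θ / 2) :=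
    Real.sin_pos_of_pos_of_lt_pi (by linarith [hθ.1]) (by linarith [hθ.1, hθ.2])
  have hc : 0 < Real.cos (θ / 2) :=
    Real.cos_pos_of_mem_Ioo ⟨by linarith [hθ.1, hθ.2], by linarith [hθ.2]⟩
  have h2 : Real.sin θ = 2 * Real.sin (θ / 2) * Real.cos (θ / 2) := by
    rw [← Real.sin_two_mul]; ring_nf
  have hcos : √((1 - Real.cos θ) / 2) = Real.sin (θ / 2) := by
    rw [show (1 - Real.cos θ) / 2 = Real.sin (θ / 2) ^ 2 by
      rw [Real.sin_sq_eq_half_sub]; ring_nf, Real.sqrt_sq hs.le]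
  simp only [hcos]
  rw [← mul_assoc, ← ENNReal.ofReal_mul (abs_nonneg _), abs_of_pos (by positivity), h2]
  ring_nf

/-- Integration over the unit sphere, with the half-angle sine as variable. -/
lemma integral_sphere_sqrt_half_one_sub_inner {n : EuclideanSpace ℝ (Fin 3)} (hn : ‖n‖ = 1)
    {Φ : ℝ → ℝ} (hΦ : Measurable Φ) (h0 : ∀ z, 0 ≤ z → 0 ≤ Φ z) :
    ∫ σ : Metric.sphere (0 : EuclideanSpace ℝ (Fin 3)) 1,
        Φ (√((1 - ⟪n, (σ : EuclideanSpace ℝ (Fin 3))⟫) / 2))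
        ∂(volume : Measure (EuclideanSpace ℝ (Fin 3))).toSphere =
      8 * Real.pi * ∫ z in (0 : ℝ)..1, z * Φ z := by
  rw [integral_eq_lintegral_of_nonneg_ae (.of_forall fun σ => h0 _ (Real.sqrt_nonneg _))
      (by
        have : Measurable fun σ : Metric.sphere (0 : EuclideanSpace ℝ (Fin 3)) 1 =>
          Φ (√((1 - ⟪n, (σ : EuclideanSpace ℝ (Fin 3))⟫) / 2)) := by fun_prop
        exact this.aestronglyMeasurable), lintegral_sphere_inner hn
      (F := fun t => ENNReal.ofReal (Φ (√((1 - t) / 2)))) (by fun_prop),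
    lintegral_sin_half (fun z => ENNReal.ofReal (Φ z)),
    intervalIntegral.integral_of_le zero_le_one, integral_Ioc_eq_integral_Ioo,
    integral_eq_lintegral_of_nonneg_ae (f := fun z => z * Φ z) ?_
      (measurable_id.mul hΦ).aestronglyMeasurable]
  · have h : ∀ z ∈ Set.Ioo (0 : ℝ) 1, ENNReal.ofReal (4 * z) * ENNReal.ofReal (Φ z) =
        ENNReal.ofReal 4 * ENNReal.ofReal (z * Φ z) := fun z hz => by
      rw [← ENNReal.ofReal_mul (by linarith [hz.1]), ← ENNReal.ofReal_mul (by norm_num), mul_assoc]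
    rw [setLIntegral_congr_fun measurableSet_Ioo h,
      lintegral_const_mul' _ _ ENNReal.ofReal_ne_top, ENNReal.toReal_mul, ENNReal.toReal_mul,
      ENNReal.toReal_ofReal (by positivity), ENNReal.toReal_ofReal (by norm_num)]
    ring
  · filter_upwards [ae_restrict_mem measurableSet_Ioo] with z hz
    exact mul_nonneg hz.1.le (h0 z hz.1.le)

/-- The kinetic energy lost in a collision. -/
lemma norm_sq_postV_add_norm_sq_postVs (e : ℝ → ℝ) (v vs : EuclideanSpace ℝ (Fin 3))
    (σ : Metric.sphere (0 : EuclideanSpace ℝ (Fin 3)) 1) :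
    ‖postV e v vs σ‖ ^ 2 + ‖postVs e v vs σ‖ ^ 2 - ‖v‖ ^ 2 - ‖vs‖ ^ 2 =
      -(‖v - vs‖ ^ 2 / 2 * ((1 - e (‖v - vs‖ *
        √((1 - ⟪‖v - vs‖⁻¹ • (v - vs), (σ : EuclideanSpace ℝ (Fin 3))⟫) / 2)) ^ 2) *
        √((1 - ⟪‖v - vs‖⁻¹ • (v - vs), (σ : EuclideanSpace ℝ (Fin 3))⟫) / 2) ^ 2)) := by
  have hle : 0 ≤ (1 - ⟪‖v - vs‖⁻¹ • (v - vs), (σ : EuclideanSpace ℝ (Fin 3))⟫) / 2 := by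
    have h1 : ‖‖v - vs‖⁻¹ • (v - vs)‖ ≤ 1 := by
      rw [norm_smul, norm_inv, norm_norm]
      exact inv_mul_le_one
    have h2 := real_inner_le_norm (‖v - vs‖⁻¹ • (v - vs)) (σ : EuclideanSpace ℝ (Fin 3))
    rw [norm_eq_of_mem_sphere σ, mul_one] at h2
    linarith
  rw [Real.sq_sqrt hle]
  simp only [postV, postVs]
  generalize e _ = ε
  rw [norm_sub_sq_real, norm_add_sq_real]
  have hw : ‖(2:ℝ)⁻¹ • (v - vs - ‖v - vs‖ • (σ : EuclideanSpace ℝ (Fin 3)))‖ ^ 2 =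
      (‖v - vs‖ ^ 2 - ‖v - vs‖ * ⟪v - vs, (σ : EuclideanSpace ℝ (Fin 3))⟫) / 2 := by
    rw [norm_smul, mul_pow, norm_sub_sq_real, norm_smul, real_inner_smul_right, norm_norm,
      norm_eq_of_mem_sphere σ]
    norm_num
    ring
  have hu : ⟪v, (2:ℝ)⁻¹ • (v - vs - ‖v - vs‖ • (σ : EuclideanSpace ℝ (Fin 3)))⟫ -
      ⟪vs, (2:ℝ)⁻¹ • (v - vs - ‖v - vs‖ • (σ : EuclideanSpace ℝ (Fin 3)))⟫ =
      (‖v - vs‖ ^ 2 - ‖v - vs‖ * ⟪v - vs, (σ : EuclideanSpace ℝ (Fin 3))⟫) / 2 := by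
    rw [← inner_sub_left, real_inner_smul_right, inner_sub_right, real_inner_self_eq_norm_sq,
      real_inner_smul_right]
    ring
  have hn : ‖v - vs‖ ^ 2 * ⟪‖v - vs‖⁻¹ • (v - vs), (σ : EuclideanSpace ℝ (Fin 3))⟫ =
      ‖v - vs‖ * ⟪v - vs, (σ : EuclideanSpace ℝ (Fin 3))⟫ := by
    rcases eq_or_ne ‖v - vs‖ 0 with h | h
    · simp [h]
    · rw [real_inner_smul_left]
      field_simp
  rw [norm_smul ((1 + ε) / 2), mul_pow, hw, Real.norm_eq_abs, sq_abs,
    real_inner_smul_right v, real_inner_smul_right vs]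
  linear_combination (-(1 + ε)) * hu - (1 - ε ^ 2) / 4 * hn

/-- The mean energy lost by a pair of particles over all directions of impact. -/
lemma integral_sphere_energy (e : ℝ → ℝ) (he_meas : Measurable e)
    (he : ∀ s : ℝ, 0 ≤ s → e s ∈ Set.Icc (0:ℝ) 1) (v vs : EuclideanSpace ℝ (Fin 3)) :
    ‖v - vs‖ * ∫ σ : Metric.sphere (0 : EuclideanSpace ℝ (Fin 3)) 1,
        (‖postV e v vs σ‖ ^ 2 + ‖postVs e v vs σ‖ ^ 2 - ‖v‖ ^ 2 - ‖vs‖ ^ 2)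
        ∂(volume : Measure (EuclideanSpace ℝ (Fin 3))).toSphere =
      -psiE e (‖v - vs‖ ^ 2) := by
  simp_rw [norm_sq_postV_add_norm_sq_postVs]
  rw [psiE, Real.sqrt_sq (norm_nonneg _), ← Real.rpow_natCast, ← Real.rpow_mul (norm_nonneg _)]
  rcases eq_or_ne (v - vs) 0 with h | h
  · simp [h]
  have hn : ‖‖v - vs‖⁻¹ • (v - vs)‖ = 1 := norm_smul_inv_norm (𝕜 := ℝ) h
  have key := integral_sphere_sqrt_half_one_sub_inner hn
    (Φ := fun z => (1 - e (‖v - vs‖ * z) ^ 2) * z ^ 2) (by fun_prop) fun z hz => by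
      have := he (‖v - vs‖ * z) (by positivity)
      have : e (‖v - vs‖ * z) ^ 2 ≤ 1 := pow_le_one₀ this.1 this.2
      exact mul_nonneg (by linarith) (sq_nonneg z)
  rw [integral_neg, integral_const_mul, key]
  norm_num [Real.rpow_ofNat]
  simp_rw [show ∀ z : ℝ, z * ((1 - e (‖v - vs‖ * z) ^ 2) * z ^ 2) =
    (1 - e (‖v - vs‖ * z) ^ 2) * z ^ 3 from fun z => by ring]
  ring

/-- The weak form of the energy dissipation of the inelastic collision
operator: for a measurable restitution coefficient `e : [0,∞) → [0,1]` and `g`, `h`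
measurable with `∫∫ |g(v_*)||h(v)||v - v_*|³ dv_* dv < ∞`,
`∫∫∫_{S²} g(v_*) h(v) |v - v_*| (|v'|² + |v'_*|² - |v|² - |v_*|²) dσ dv_* dv
  = -∫∫ g(v_*) h(v) ψ_e(|v - v_*|²) dv_* dv`. -/
theorem stmt7
    (e : ℝ → ℝ) (he_meas : Measurable e) (he : ∀ s : ℝ, 0 ≤ s → e s ∈ Set.Icc (0:ℝ) 1)
    (g h : EuclideanSpace ℝ (Fin 3) → ℝ) (hg : Measurable g) (hh : Measurable h)
    (hint : Integrable (fun p : EuclideanSpace ℝ (Fin 3) × EuclideanSpace ℝ (Fin 3) =>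
      |g p.2| * |h p.1| * ‖p.1 - p.2‖ ^ 3)) :
    (∫ v : EuclideanSpace ℝ (Fin 3), ∫ vs : EuclideanSpace ℝ (Fin 3),
        ∫ σ : Metric.sphere (0 : EuclideanSpace ℝ (Fin 3)) 1,
          g vs * h v * ‖v - vs‖ *
            (‖postV e v vs σ‖ ^ 2 + ‖postVs e v vs σ‖ ^ 2 - ‖v‖ ^ 2 - ‖vs‖ ^ 2)
          ∂((volume : Measure (EuclideanSpace ℝ (Fin 3))).toSphere)) =
      -∫ v : EuclideanSpace ℝ (Fin 3), ∫ vs : EuclideanSpace ℝ (Fin 3),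
          g vs * h v * psiE e (‖v - vs‖ ^ 2) := by
  simp_rw [integral_const_mul, mul_assoc, integral_sphere_energy e he_meas he, mul_neg,
    integral_neg]
end

section
/- Let a, b > 0 and 0 < γ < γ̄, and let e : [0,∞) → (0,1] be measurable with |e(s) − 1 + a s^γ| ≤ b s^{γ̄} for all s ≥ 0. Then there exists a constant C > 0 such that for every λ ∈ (0,1] and every r > 0, |ζ_λ(r²) − ζ₀(r²)| ≤ C ( r^{3+2γ} λ^γ + r^{3+γ+γ̄} λ^{γ̄} + r^{3+γ̄} λ^{γ̄−γ} ). -/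
open MeasureTheory

/-- `ζ_λ(ρ) = λ^{-3-γ} ψ_e(λ² ρ)`. -/
noncomputable def zetaLam (e : ℝ → ℝ) (γ lam ρ : ℝ) : ℝ :=
  lam ^ (-(3 + γ)) * psiE e (lam ^ 2 * ρ)

/-- `ζ₀(ρ) = (8πa/(4+γ)) ρ^{(3+γ)/2}`. -/
noncomputable def zeta0 (a γ ρ : ℝ) : ℝ :=
  (8 * Real.pi * a / (4 + γ)) * ρ ^ ((3 + γ) / 2)

/-- Pointwise expansion of `1 - e²`, where `x = s^γ` and `y = s^γ̄`. -/
lemma abs_one_sub_sq_sub_le {a b v x y : ℝ} (ha : 0 < a) (hx : 0 ≤ x)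
    (hv : v ∈ Set.Ioc (0:ℝ) 1) (h : |v - 1 + a * x| ≤ b * y) :
    |1 - v ^ 2 - 2 * a * x| ≤ a ^ 2 * x ^ 2 + a * b * (x * y) + 3 * b * y := by
  obtain ⟨h0, h1⟩ := hv
  obtain ⟨hl, hu⟩ := abs_le.mp h
  have hax : 0 ≤ a * x := mul_nonneg ha.le hx
  have hby : 0 ≤ b * y := (abs_nonneg _).trans h
  have hsq : (1 - v) ^ 2 ≤ a ^ 2 * x ^ 2 + a * b * (x * y) + b * y := by
    nlinarith [mul_le_mul_of_nonneg_left (show 1 - v ≤ a * x + b * y by linarith) hax,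
      mul_le_mul_of_nonneg_left (show 1 - v ≤ a * x + b * y by linarith)
        (show 0 ≤ 1 - v by linarith), mul_nonneg hby h0.le]
  rw [abs_le]
  constructor <;> nlinarith [sq_nonneg (1 - v), mul_nonneg hax hby, sq_nonneg (a * x)]

lemma abs_integral_one_sub_sq_sub_le {a b γ γbar : ℝ} (ha : 0 < a) (hb : 0 < b) (hγ : 0 < γ)
    (hγbar : 0 < γbar) {e : ℝ → ℝ} (he_meas : Measurable e)
    (he_range : ∀ s : ℝ, 0 ≤ s → e s ∈ Set.Ioc (0:ℝ) 1)
    (he : ∀ s : ℝ, 0 ≤ s → |e s - 1 + a * s ^ γ| ≤ b * s ^ γbar) {t : ℝ} (ht : 0 < t) :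
    |(∫ z in (0:ℝ)..1, (1 - (e (t * z)) ^ 2) * z ^ 3) - 2 * a / (4 + γ) * t ^ γ| ≤
      a ^ 2 * t ^ (2 * γ) + a * b * t ^ (γ + γbar) + 3 * b * t ^ γbar := by
  have he_int : IntervalIntegrable (fun z : ℝ => (1 - (e (t * z)) ^ 2) * z ^ 3) volume 0 1 := by
    rw [intervalIntegrable_iff]
    refine Measure.integrableOn_of_bounded (M := 1) (by simp)
      (Measurable.aestronglyMeasurable (by fun_prop)) ?_
    filter_upwards [ae_restrict_mem measurableSet_uIoc] with z hz
    rw [Set.uIoc_of_le zero_le_one] at hz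
    obtain ⟨h0, h1⟩ := he_range (t * z) (mul_nonneg ht.le hz.1.le)
    rw [norm_mul, ← one_mul (1:ℝ)]
    refine mul_le_mul ?_ ?_ (norm_nonneg _) zero_le_one
    · rw [Real.norm_eq_abs, abs_le]
      constructor <;> nlinarith
    · rw [Real.norm_eq_abs, abs_of_nonneg (pow_nonneg hz.1.le 3)]
      exact pow_le_one₀ hz.1.le hz.2
  have hpow_int : IntervalIntegrable (fun z : ℝ => 2 * a * t ^ γ * z ^ (γ + 3)) volume 0 1 :=
    (intervalIntegral.intervalIntegrable_rpow' (by linarith)).const_mul _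
  have hmain : ∫ z in (0:ℝ)..1, 2 * a * t ^ γ * z ^ (γ + 3) = 2 * a / (4 + γ) * t ^ γ := by
    rw [intervalIntegral.integral_const_mul, integral_rpow (Or.inl (by linarith)),
      Real.one_rpow, Real.zero_rpow (by linarith), show γ + 3 + 1 = 4 + γ by ring]
    field_simp
    ring
  rw [← hmain, ← intervalIntegral.integral_sub he_int hpow_int]
  suffices hbound : ∀ z ∈ Set.uIoc (0:ℝ) 1,
      ‖(1 - e (t * z) ^ 2) * z ^ 3 - 2 * a * t ^ γ * z ^ (γ + 3)‖ ≤
        a ^ 2 * t ^ (2 * γ) + a * b * t ^ (γ + γbar) + 3 * b * t ^ γbar by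
    simpa using intervalIntegral.norm_integral_le_of_norm_le_const hbound
  intro z hz
  rw [Set.uIoc_of_le zero_le_one] at hz
  have hs : 0 ≤ t * z := mul_nonneg ht.le hz.1.le
  have hst : t * z ≤ t := mul_le_of_le_one_right ht.le hz.2
  have hpt := abs_one_sub_sq_sub_le ha (Real.rpow_nonneg hs γ) (he_range _ hs) (he _ hs)
  have hx : (t * z) ^ γ ≤ t ^ γ := Real.rpow_le_rpow hs hst hγ.le
  have hy : (t * z) ^ γbar ≤ t ^ γbar := Real.rpow_le_rpow hs hst hγbar.le
  have hfac : (1 - e (t * z) ^ 2) * z ^ 3 - 2 * a * t ^ γ * z ^ (γ + 3) =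
      (1 - e (t * z) ^ 2 - 2 * a * (t * z) ^ γ) * z ^ 3 := by
    rw [Real.rpow_add hz.1, Real.mul_rpow ht.le hz.1.le,
      show z ^ (3:ℝ) = z ^ 3 from Real.rpow_natCast z 3]
    ring
  rw [hfac, Real.norm_eq_abs, abs_mul, abs_of_nonneg (pow_nonneg hz.1.le 3)]
  refine (mul_le_of_le_one_right (abs_nonneg _) (pow_le_one₀ hz.1.le hz.2)).trans (hpt.trans ?_)
  rw [two_mul γ, Real.rpow_add ht, Real.rpow_add ht, ← sq]
  have hx0 : 0 ≤ (t * z) ^ γ := Real.rpow_nonneg hs γ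
  have hy0 : 0 ≤ (t * z) ^ γbar := Real.rpow_nonneg hs γbar
  gcongr

/-- Under the assumption `|e(s) - 1 + a s^γ| ≤ b s^{γ̄}`, there is a
constant `C > 0` such that for every `λ ∈ (0,1]` and every `r > 0`,
`|ζ_λ(r²) - ζ₀(r²)| ≤ C (r^{3+2γ} λ^γ + r^{3+γ+γ̄} λ^{γ̄} + r^{3+γ̄} λ^{γ̄-γ})`. -/
theorem stmt10
    (a b γ γbar : ℝ) (ha : 0 < a) (hb : 0 < b) (hγ : 0 < γ) (hγbar : γ < γbar)
    (e : ℝ → ℝ) (he_meas : Measurable e)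
    (he_range : ∀ s : ℝ, 0 ≤ s → e s ∈ Set.Ioc (0:ℝ) 1)
    (he : ∀ s : ℝ, 0 ≤ s → |e s - 1 + a * s ^ γ| ≤ b * s ^ γbar) :
    ∃ C : ℝ, 0 < C ∧ ∀ lam : ℝ, lam ∈ Set.Ioc (0:ℝ) 1 → ∀ r : ℝ, 0 < r →
      |zetaLam e γ lam (r ^ 2) - zeta0 a γ (r ^ 2)| ≤
        C * (r ^ (3 + 2 * γ) * lam ^ γ + r ^ (3 + γ + γbar) * lam ^ γbar +
          r ^ (3 + γbar) * lam ^ (γbar - γ)) := by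
  refine ⟨4 * Real.pi * (a ^ 2 + a * b + 3 * b), by positivity, ?_⟩
  rintro lam ⟨hl, -⟩ r hr
  have ht : 0 < lam * r := mul_pos hl hr
  have hI := abs_integral_one_sub_sq_sub_le ha hb hγ (hγ.trans hγbar) he_meas he_range he ht
  set I := ∫ z in (0:ℝ)..1, (1 - (e (lam * r * z)) ^ 2) * z ^ 3 with hI_def
  have hscale (p : ℝ) :
      lam ^ (-(3 + γ)) * (lam * r) ^ (3:ℝ) * (lam * r) ^ p = r ^ (3 + p) * lam ^ (p - γ) := by
    rw [mul_assoc, ← Real.rpow_add ht, Real.mul_rpow hl.le hr.le, ← mul_assoc,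
      ← Real.rpow_add hl, mul_comm]
    congr 2
    ring
  have hzeta : zetaLam e γ lam (r ^ 2) =
      4 * Real.pi * (lam ^ (-(3 + γ)) * (lam * r) ^ (3:ℝ)) * I := by
    have hpow : ((lam * r) ^ 2) ^ ((3:ℝ) / 2) = (lam * r) ^ (3:ℝ) := by
      rw [← Real.rpow_natCast, ← Real.rpow_mul ht.le]
      norm_num
    rw [zetaLam, psiE, ← mul_pow, Real.sqrt_sq ht.le, hpow, ← hI_def]
    ring
  have hzero : zeta0 a γ (r ^ 2) =
      4 * Real.pi * (lam ^ (-(3 + γ)) * (lam * r) ^ (3:ℝ)) *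
        (2 * a / (4 + γ) * (lam * r) ^ γ) := by
    have hpow : (r ^ 2) ^ ((3 + γ) / 2) = r ^ (3 + γ) := by
      rw [← Real.rpow_natCast, ← Real.rpow_mul hr.le]
      congr 1
      push_cast
      ring
    have hγscale := hscale γ
    rw [sub_self, Real.rpow_zero, mul_one] at hγscale
    rw [zeta0, hpow, ← hγscale]
    ring
  set K := lam ^ (-(3 + γ)) * (lam * r) ^ (3:ℝ) with hK_def
  have hK : 0 ≤ K := by positivity
  have h₁ := hscale (2 * γ)
  have h₂ := hscale (γ + γbar)
  have h₃ := hscale γbar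
  rw [show 2 * γ - γ = γ by ring] at h₁
  rw [show γ + γbar - γ = γbar by ring, ← add_assoc] at h₂
  have hA : 0 ≤ (lam * r) ^ (2 * γ) := by positivity
  have hB : 0 ≤ (lam * r) ^ (γ + γbar) := by positivity
  have hD : 0 ≤ (lam * r) ^ γbar := by positivity
  rw [hzeta, hzero, ← mul_sub, abs_mul, abs_of_nonneg (by positivity), ← h₁, ← h₂, ← h₃,
    ← mul_add, ← mul_add]
  set A := (lam * r) ^ (2 * γ)
  set B := (lam * r) ^ (γ + γbar)
  set D := (lam * r) ^ γbar
  have hsum : a ^ 2 * A + a * b * B + 3 * b * D ≤ (a ^ 2 + a * b + 3 * b) * (A + B + D) := by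
    have h0 : 0 ≤ a ^ 2 * (B + D) + a * b * (A + D) + 3 * b * (A + B) := by positivity
    linarith
  calc 4 * Real.pi * K * |I - 2 * a / (4 + γ) * (lam * r) ^ γ|
      ≤ 4 * Real.pi * K * ((a ^ 2 + a * b + 3 * b) * (A + B + D)) := by
        gcongr
        exact hI.trans hsum
    _ = 4 * Real.pi * (a ^ 2 + a * b + 3 * b) * (K * (A + B + D)) := by ring
end

section
/- Let b > 0, β ∈ (0,1) and q ∈ ℕ, and define the weight w(v) := (1+|v|²)^{q/2} e^{b (1+|v|²)^{β/2}} on ℝ³. Then w is smooth and the function Δw / w is bounded on ℝ³: there exists C > 0 such that |Δw(v)| ≤ C w(v) for all v ∈ ℝ³. -/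
open MeasureTheory

/-- The Laplacian `Δf(v) = ∑ᵢ ∂²f/∂vᵢ²` on `ℝ³`, expressed via the second iterated
Fréchet derivative applied to the coordinate directions. -/
noncomputable def lap (f : EuclideanSpace ℝ (Fin 3) → ℝ)
    (v : EuclideanSpace ℝ (Fin 3)) : ℝ :=
  ∑ i : Fin 3,
    iteratedFDeriv ℝ 2 f v ![EuclideanSpace.single i 1, EuclideanSpace.single i 1]

theorem hasFDerivAt_one_add_norm_sq (v : EuclideanSpace ℝ (Fin 3)) :
    HasFDerivAt (fun v : EuclideanSpace ℝ (Fin 3) => 1 + ‖v‖ ^ 2) ((2 : ℝ) • innerSL ℝ v) v := by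
  rw [ofNat_smul_eq_nsmul]
  exact (hasStrictFDerivAt_norm_sq v).hasFDerivAt.const_add 1

/-- Second derivative of a radial function `g(1+|v|²)` with `g' = gφ` and `φ' = ψ`. -/
theorem iteratedFDeriv_two_radial {g φ ψ : ℝ → ℝ}
    (hg : ∀ t, 0 < t → HasDerivAt g (g t * φ t) t)
    (hφ : ∀ t, 0 < t → HasDerivAt φ (ψ t) t) (v e : EuclideanSpace ℝ (Fin 3)) :
    iteratedFDeriv ℝ 2 (fun v : EuclideanSpace ℝ (Fin 3) => g (1 + ‖v‖ ^ 2)) v ![e, e] =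
      g (1 + ‖v‖ ^ 2) * (2 * φ (1 + ‖v‖ ^ 2) * ‖e‖ ^ 2 +
        4 * (inner ℝ v e) ^ 2 * (φ (1 + ‖v‖ ^ 2) ^ 2 + ψ (1 + ‖v‖ ^ 2))) := by
  have hpos (x : EuclideanSpace ℝ (Fin 3)) : 0 < 1 + ‖x‖ ^ 2 := by positivity
  have hG (x : EuclideanSpace ℝ (Fin 3)) :=
    (hg _ (hpos x)).comp_hasFDerivAt x (hasFDerivAt_one_add_norm_sq x)
  have hΦ := (hφ _ (hpos v)).comp_hasFDerivAt v (hasFDerivAt_one_add_norm_sq v)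
  have h1 : fderiv ℝ (fun v : EuclideanSpace ℝ (Fin 3) => g (1 + ‖v‖ ^ 2)) = fun x =>
      (g (1 + ‖x‖ ^ 2) * φ (1 + ‖x‖ ^ 2)) • ((2 : ℝ) • innerSL ℝ x) :=
    funext fun x => (hG x).fderiv
  let B : EuclideanSpace ℝ (Fin 3) →L[ℝ] EuclideanSpace ℝ (Fin 3) →L[ℝ] ℝ := innerSL ℝ
  have hB (x y : EuclideanSpace ℝ (Fin 3)) : B x y = inner ℝ x y := rfl
  have h2 := ((hG v).mul hΦ).smul ((B.hasFDerivAt (x := v)).const_smul (2 : ℝ))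
  have h3 := h2.fderiv
  rw [iteratedFDeriv_two_apply, h1]
  refine (congrArg (fun L => L e e) h3).trans ?_
  simp only [add_apply, smul_apply, ContinuousLinearMap.smulRight_apply, innerSL_apply_apply, hB,
    smul_eq_mul, Function.comp_apply, Pi.mul_apply, Pi.smul_apply, real_inner_self_eq_norm_sq]
  ring

theorem abs_lap_radial_le {g φ ψ : ℝ → ℝ} {K L : ℝ}
    (hg : ∀ t, 0 < t → HasDerivAt g (g t * φ t) t)
    (hφ : ∀ t, 0 < t → HasDerivAt φ (ψ t) t) (hg0 : ∀ t, 0 < t → 0 < g t)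
    (hK : ∀ t, 1 ≤ t → |φ t| ≤ K) (hL : ∀ t, 1 ≤ t → t * |φ t ^ 2 + ψ t| ≤ L)
    (v : EuclideanSpace ℝ (Fin 3)) :
    |lap (fun v => g (1 + ‖v‖ ^ 2)) v| ≤ 3 * (2 * K + 4 * L) * g (1 + ‖v‖ ^ 2) := by
  have ht : 1 ≤ 1 + ‖v‖ ^ 2 := by nlinarith [sq_nonneg ‖v‖]
  have hgt := hg0 _ (zero_lt_one.trans_le ht)
  have key (i : Fin 3) : |iteratedFDeriv ℝ 2 (fun v : EuclideanSpace ℝ (Fin 3) =>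
      g (1 + ‖v‖ ^ 2)) v ![EuclideanSpace.single i 1, EuclideanSpace.single i 1]| ≤
      (2 * K + 4 * L) * g (1 + ‖v‖ ^ 2) := by
    set e : EuclideanSpace ℝ (Fin 3) := EuclideanSpace.single i 1 with he
    have hn : ‖e‖ = 1 := by simp [he]
    have hin : (inner ℝ v e) ^ 2 ≤ 1 + ‖v‖ ^ 2 := by
      have h := abs_real_inner_le_norm v e
      rw [hn, mul_one] at h
      have := sq_le_sq' (abs_le.mp h).1 (abs_le.mp h).2
      linarith
    rw [iteratedFDeriv_two_radial hg hφ, hn, abs_mul, abs_of_pos hgt, mul_comm]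
    refine mul_le_mul_of_nonneg_right ?_ hgt.le
    refine (abs_add_le _ _).trans (add_le_add ?_ ?_)
    · rw [one_pow, mul_one, abs_mul, abs_two]
      linarith [hK _ ht]
    · rw [abs_mul, abs_of_nonneg (by positivity), mul_assoc]
      have := (mul_le_mul_of_nonneg_right hin (abs_nonneg _)).trans (hL _ ht)
      linarith
  unfold lap
  refine (Finset.abs_sum_le_sum_abs _ _).trans ((Finset.sum_le_sum fun i _ => key i).trans ?_)
  simp [mul_assoc]

theorem hasDerivAt_rpow_mul_exp_rpow (a b c : ℝ) {t : ℝ} (ht : 0 < t) :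
    HasDerivAt (fun t : ℝ => t ^ a * Real.exp (b * t ^ c))
      (t ^ a * Real.exp (b * t ^ c) * (a * t ^ (-1 : ℝ) + b * c * t ^ (c - 1))) t := by
  have h1 := Real.hasDerivAt_rpow_const (p := a) (Or.inl ht.ne')
  have h2 := Real.hasDerivAt_rpow_const (p := c) (Or.inl ht.ne')
  refine (h1.mul (h2.const_mul b).exp).congr_deriv ?_
  rw [sub_eq_add_neg a, Real.rpow_add ht]
  ring

theorem hasDerivAt_logDeriv_rpow_mul_exp_rpow (a b c : ℝ) {t : ℝ} (ht : 0 < t) :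
    HasDerivAt (fun t : ℝ => a * t ^ (-1 : ℝ) + b * c * t ^ (c - 1))
      (-a * t ^ (-2 : ℝ) + b * c * (c - 1) * t ^ (c - 2)) t := by
  have h1 := Real.hasDerivAt_rpow_const (p := -1) (Or.inl ht.ne')
  have h2 := Real.hasDerivAt_rpow_const (p := c - 1) (Or.inl ht.ne')
  refine ((h1.const_mul a).add (h2.const_mul (b * c))).congr_deriv ?_
  rw [show (-1 : ℝ) - 1 = -2 by norm_num, show c - 1 - 1 = c - 2 by ring]
  ring

/-- The stretched exponential weight
`w(v) = ⟨v⟩^q e^{b⟨v⟩^β}`, `⟨v⟩ = (1+|v|²)^{1/2}`, with `b > 0`, `β ∈ (0,1)`, `q ∈ ℕ`,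
is smooth and satisfies `|Δw| ≤ C w` on `ℝ³` for some constant `C > 0`. -/
theorem stmt13 (b β : ℝ) (hb : 0 < b) (hβ0 : 0 < β) (hβ1 : β < 1) (q : ℕ) :
    let w : EuclideanSpace ℝ (Fin 3) → ℝ := fun v =>
      (1 + ‖v‖ ^ 2) ^ ((q : ℝ) / 2) * Real.exp (b * (1 + ‖v‖ ^ 2) ^ (β / 2))
    ContDiff ℝ (⊤ : ℕ∞) w ∧ ∃ C : ℝ, 0 < C ∧ ∀ v : EuclideanSpace ℝ (Fin 3),
      |lap w v| ≤ C * w v := by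
  intro w
  refine ⟨?_, ?_⟩
  · have hs : ContDiff ℝ (⊤ : ℕ∞) fun v : EuclideanSpace ℝ (Fin 3) => 1 + ‖v‖ ^ 2 :=
      contDiff_const.add (contDiff_norm_sq ℝ)
    have hne (v : EuclideanSpace ℝ (Fin 3)) : 1 + ‖v‖ ^ 2 ≠ 0 := by positivity
    exact (hs.rpow_const_of_ne hne).mul (contDiff_const.mul (hs.rpow_const_of_ne hne)).exp
  · set a : ℝ := (q : ℝ) / 2
    set c : ℝ := β / 2 with hc
    have ha : 0 ≤ a := by positivity
    have hc0 : 0 < c := by positivity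
    have hd : 0 ≤ b * c := by positivity
    set d := b * c
    refine ⟨3 * (2 * (a + d) + 4 * ((a + d) ^ 2 + (a + d))) + 1, by positivity, fun v => ?_⟩
    have hw : 0 < w v := by positivity
    have hpow (t : ℝ) (ht : 1 ≤ t) (r : ℝ) (hr : r ≤ 0) : 0 ≤ t ^ r ∧ t ^ r ≤ 1 :=
      ⟨by positivity, Real.rpow_le_one_of_one_le_of_nonpos ht hr⟩
    have main : |lap w v| ≤ 3 * (2 * (a + d) + 4 * ((a + d) ^ 2 + (a + d))) * w v := by
      refine abs_lap_radial_le (g := fun t => t ^ a * Real.exp (b * t ^ c))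
        (fun t ht => hasDerivAt_rpow_mul_exp_rpow a b c ht)
        (fun t ht => hasDerivAt_logDeriv_rpow_mul_exp_rpow a b c ht)
        (fun t ht => by positivity) (fun t ht => ?_) (fun t ht => ?_) v
      · obtain ⟨h1, h1'⟩ := hpow t ht (-1) (by norm_num)
        obtain ⟨h2, h2'⟩ := hpow t ht (c - 1) (by linarith)
        rw [abs_of_nonneg (by positivity)]
        exact add_le_add (mul_le_of_le_one_right ha h1') (mul_le_of_le_one_right hd h2')
      · have ht0 : 0 < t := by linarith
        obtain ⟨h1, h1'⟩ := hpow t ht (-1 / 2) (by norm_num)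
        obtain ⟨h2, h2'⟩ := hpow t ht (c - 1 / 2) (by linarith)
        obtain ⟨h3, h3'⟩ := hpow t ht (-1) (by norm_num)
        obtain ⟨h4, h4'⟩ := hpow t ht (c - 1) (by linarith)
        have e0 : t = t ^ (1 / 2 : ℝ) * t ^ (1 / 2 : ℝ) := by
          rw [← Real.rpow_add ht0]; norm_num
        have e1 : t ^ (-1 / 2 : ℝ) = t ^ (1 / 2 : ℝ) * t ^ (-1 : ℝ) := by
          rw [← Real.rpow_add ht0]; norm_num
        have e2 : t ^ (c - 1 / 2) = t ^ (1 / 2 : ℝ) * t ^ (c - 1) := by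
          rw [← Real.rpow_add ht0]; ring_nf
        have e3 : t ^ (-1 : ℝ) = t * t ^ (-2 : ℝ) := by
          rw [← Real.rpow_one_add' ht0.le (by norm_num)]; norm_num
        have e4 : t ^ (c - 1) = t * t ^ (c - 2) := by
          rw [← Real.rpow_one_add' ht0.le (by linarith)]; ring_nf
        have hsplit : t * ((a * t ^ (-1 : ℝ) + d * t ^ (c - 1)) ^ 2 +
            (-a * t ^ (-2 : ℝ) + d * (c - 1) * t ^ (c - 2))) =
            (a * t ^ (-1 / 2 : ℝ) + d * t ^ (c - 1 / 2)) ^ 2 -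
              (a * t ^ (-1 : ℝ) + d * ((1 - c) * t ^ (c - 1))) := by
          have hsq : t * (a * t ^ (-1 : ℝ) + d * t ^ (c - 1)) ^ 2 =
              (a * t ^ (-1 / 2 : ℝ) + d * t ^ (c - 1 / 2)) ^ 2 := by
            rw [e1, e2]
            linear_combination (a * t ^ (-1 : ℝ) + d * t ^ (c - 1)) ^ 2 * e0
          linear_combination hsq + a * e3 + d * (1 - c) * e4
        rw [← abs_of_pos ht0, ← abs_mul, abs_of_pos ht0, hsplit]
        have hc1 : 0 ≤ 1 - c := by linarith
        have hq : (1 - c) * t ^ (c - 1) ≤ 1 := mul_le_one₀ (by linarith) h4 h4'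
        have hq0 : 0 ≤ (1 - c) * t ^ (c - 1) := mul_nonneg hc1 h4
        refine (abs_sub _ _).trans (add_le_add ?_ ?_)
        · rw [abs_of_nonneg (by positivity)]
          exact pow_le_pow_left₀ (by positivity) (add_le_add (mul_le_of_le_one_right ha h1')
            (mul_le_of_le_one_right hd h2')) 2
        · rw [abs_of_nonneg (by positivity)]
          exact add_le_add (mul_le_of_le_one_right ha h3') (mul_le_of_le_one_right hd hq)
    linarith
end
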